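/- For every λ ∈ P⁺, ℓ ≥ 1 and i ∈ {1,…,n}, the relation ⪰ of the (λ,i)-poset is a partial order on R_i⁺ = {α ∈ R⁺ : ϖ_i(h_α) = 1}; that is, ⪰ is reflexive, antisymmetric, and transitive. -/

import Mathlib

noncomputable section

namespace DemazurePaper

/-- Integral weights of `sl_{n+1}` in fundamental-weight coordinates. -/
abbrev Wt (n : ℕ) := Fin n → ℤ

/-- Dominant integral weights. -/
def IsDominant {n : ℕ} (μ : Wt n) : Prop := ∀ j, 0 ≤ μ j

/-- coordinates of a weight, extended by zero -/
def wtc {n : ℕ} (μ : Wt n) (r : ℕ) : ℤ := if h : r < n then μ ⟨r, h⟩ else 0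

/-- `μ(h_α)` for the root `α = ε_{a+1} - ε_{b+1}` (0-indexed, `a < b`);
equivalently `μ(h_{a+1,b})` for the positive root `α_{a+1,b}`. -/
def pairing {n : ℕ} (μ : Wt n) (a b : ℕ) : ℤ := ∑ r ∈ Finset.Ico a b, wtc μ r

/-- `s_α`, determined by `μ(h_α) = (s_α - 1)ℓ + m_α`, `1 ≤ m_α ≤ ℓ`. -/
def svalI (ℓ : ℕ) (N : ℤ) : ℕ := if N.toNat % ℓ = 0 then N.toNat / ℓ else N.toNat / ℓ + 1

/-- `m_α`, determined by `μ(h_α) = (s_α - 1)ℓ + m_α`, `1 ≤ m_α ≤ ℓ`. -/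
def mvalI (ℓ : ℕ) (N : ℤ) : ℕ := if N.toNat % ℓ = 0 then ℓ else N.toNat % ℓ

/-- `m_{ε_a − ε_b}` (0-indexed `a < b`) for the weight `μ` and divisor `ℓ` -/
def mRoot {n : ℕ} (ℓ : ℕ) (μ : Wt n) (a b : ℕ) : ℕ := mvalI ℓ (pairing μ a b)

/-- `s_{ε_a − ε_b}` (0-indexed `a < b`) for the weight `μ` and divisor `ℓ` -/
def sRoot {n : ℕ} (ℓ : ℕ) (μ : Wt n) (a b : ℕ) : ℕ := svalI ℓ (pairing μ a b)


/-- Positive roots of `sl_{n+1}` encoded as intervals: the pair `(a,b)` with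
`1 ≤ a ≤ b ≤ n` encodes `α_{a,b} = ε_a − ε_{b+1}`, with support `{a,…,b}`. -/
abbrev Intv := ℕ × ℕ

/-- `(a,b)` encodes a positive root `α_{a,b}` -/
def IsPosRoot (n : ℕ) (p : Intv) : Prop := 1 ≤ p.1 ∧ p.1 ≤ p.2 ∧ p.2 ≤ n

/-- membership in `R_i⁺ = {α ∈ R⁺ : ϖ_i(h_α) = 1}` -/
def InRi (n i : ℕ) (p : Intv) : Prop := IsPosRoot n p ∧ p.1 ≤ i ∧ i ≤ p.2

/-- `m_α` for the positive root `α = α_{a,b}` encoded by the interval `p = (a,b)` -/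
def mIv {n : ℕ} (ℓ : ℕ) (μ : Wt n) (p : Intv) : ℕ := mvalI ℓ (pairing μ (p.1 - 1) p.2)

/-- `α ∪ β`: the root supported on `supp(α) ∪ supp(β)` -/
def cupR (p q : Intv) : Intv := (min p.1 q.1, max p.2 q.2)

/-- `α ∩ β`: the root supported on `supp(α) ∩ supp(β)` -/
def capR (p q : Intv) : Intv := (max p.1 q.1, min p.2 q.2)

/-- `α − β ∈ R` for `α ≠ β` in `R_i⁺`: the intervals share exactly one endpoint -/
def DiffIsRoot (p q : Intv) : Prop := (p.1 = q.1 ∧ p.2 ≠ q.2) ∨ (p.2 = q.2 ∧ p.1 ≠ q.1)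

/-- the root `(α∪β) − (α∩β)` in case `α − β ∈ R` -/
def cupSubCap (p q : Intv) : Intv :=
  if p.1 = q.1 then (min p.2 q.2 + 1, max p.2 q.2) else (min p.1 q.1, max p.1 q.1 - 1)

/-- the left flanking root `γ₁` of `supp(α∩β)` inside `supp(α∪β)` -/
def gamma1 (p q : Intv) : Intv := ((cupR p q).1, (capR p q).1 - 1)

/-- the right flanking root `γ₂` of `supp(α∩β)` inside `supp(α∪β)` -/
def gamma2 (p q : Intv) : Intv := ((capR p q).2 + 1, (cupR p q).2)

/-- the root `(α∪β) − α` in case `α∩β ∉ {α,β}` -/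
def cupSubFst (p q : Intv) : Intv :=
  if q.1 < p.1 then (q.1, p.1 - 1) else (p.2 + 1, q.2)

/-- The `(λ,i)`-poset relation `α ⪰ β` on `R_i⁺` (Definition 5.2 of the paper). -/
def PosetGE {n : ℕ} (ℓ : ℕ) (μ : Wt n) (p q : Intv) : Prop :=
  p = q ∨
  -- (i) `α − β ∈ R`
  (DiffIsRoot p q ∧
    (mIv ℓ μ (cupR p q) : ℤ) =
      mIv ℓ μ (capR p q) + mIv ℓ μ (cupSubCap p q) -
        ℓ * (if p = capR p q then 1 else 0)) ∨
  -- (ii) `α − β ∉ R` and `α∩β ∈ {α, β}`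
  (¬ DiffIsRoot p q ∧ (capR p q = p ∨ capR p q = q) ∧
    (mIv ℓ μ (cupR p q) : ℤ) =
      mIv ℓ μ (capR p q) + mIv ℓ μ (gamma1 p q) + mIv ℓ μ (gamma2 p q) -
        2 * ℓ * (if p = capR p q then 1 else 0)) ∨
  -- (iii) `α − β ∉ R` and `α∩β ∉ {α, β}`
  (¬ DiffIsRoot p q ∧ ¬ (capR p q = p ∨ capR p q = q) ∧
    (mIv ℓ μ (cupR p q) : ℤ) = mIv ℓ μ p + mIv ℓ μ (cupSubFst p q) - ℓ ∧
    (mIv ℓ μ (cupR p q) : ℤ) = mIv ℓ μ q + mIv ℓ μ (cupSubFst q p))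


/-- The cost of the wrap-around met when walking upwards from `x` to `y` on a circle of
circumference `L`, where `k` sits at height `c k` and ties are broken by decreasing index. -/
def wrap (L : ℤ) (c : ℕ → ℤ) (x y : ℕ) : ℤ :=
  if c y < c x ∨ (c y = c x ∧ x < y) then L else 0

lemma wrap_self (L : ℤ) (c : ℕ → ℤ) (x : ℕ) : wrap L c x x = 0 := by
  simp [wrap]

lemma wrap_nonneg {L : ℤ} (hL : 0 < L) (c : ℕ → ℤ) (x y : ℕ) : 0 ≤ wrap L c x y := by
  unfold wrap; split_ifs <;> omega

lemma wrap_triangle {L : ℤ} (hL : 0 < L) (c : ℕ → ℤ) (x y z : ℕ) :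
    wrap L c x z ≤ wrap L c x y + wrap L c y z := by
  unfold wrap; split_ifs <;> omega

lemma wrap_add_swap {c : ℕ → ℤ} (L : ℤ) {x y : ℕ} (h : x ≠ y) :
    wrap L c x y + wrap L c y x = L := by
  unfold wrap; split_ifs <;> omega

lemma mvalI_sub {ℓ : ℕ} (hl : 1 ≤ ℓ) (S : ℕ → ℤ) {x y : ℕ} (hxy : x < y) (h : S x ≤ S y) :
    (mvalI ℓ (S y - S x) : ℤ) =
      S y % ℓ - S x % ℓ + wrap ℓ (fun k => S k % ℓ) x y := by
  have hL : (0 : ℤ) < ℓ := by omega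
  have hm : (((S y - S x).toNat % ℓ : ℕ) : ℤ) = (S y % ℓ - S x % ℓ) % ℓ := by
    rw [Int.natCast_mod, Int.toNat_of_nonneg (by omega), Int.sub_emod]
  have hx := Int.emod_nonneg (S x) hL.ne'
  have hy := Int.emod_nonneg (S y) hL.ne'
  have hx' := Int.emod_lt_of_pos (S x) hL
  have hy' := Int.emod_lt_of_pos (S y) hL
  unfold mvalI wrap
  dsimp only
  rcases lt_or_ge (S y % ℓ) (S x % ℓ) with huv | huv
  · rw [← Int.add_emod_right, Int.emod_eq_of_lt (by omega) (by omega)] at hm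
    split_ifs <;> omega
  · rw [Int.emod_eq_of_lt (by omega) (by omega)] at hm
    split_ifs <;> omega

lemma pairing_eq_sub {n : ℕ} (μ : Wt n) {a b : ℕ} (h : a ≤ b) :
    pairing μ a b = pairing μ 0 b - pairing μ 0 a := by
  unfold pairing
  rw [← Finset.sum_Ico_consecutive _ (Nat.zero_le a) h]
  ring

lemma pairing_nonneg {n : ℕ} {μ : Wt n} (hμ : IsDominant μ) (a b : ℕ) : 0 ≤ pairing μ a b := by
  refine Finset.sum_nonneg fun r _ => ?_
  unfold wtc
  split_ifs
  exacts [hμ _, le_rfl]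

/-- The residue modulo `ℓ` of the partial sums of the coordinates of `μ`. -/
def height {n : ℕ} (ℓ : ℕ) (μ : Wt n) (k : ℕ) : ℤ := pairing μ 0 k % ℓ

lemma mIv_eq {n ℓ : ℕ} (hl : 1 ≤ ℓ) {μ : Wt n} (hμ : IsDominant μ) {a b : ℕ} (h : a < b) :
    (mIv ℓ μ (a + 1, b) : ℤ) = height ℓ μ b - height ℓ μ a + wrap ℓ (height ℓ μ) a b := by
  have h0 := pairing_nonneg hμ a b
  unfold mIv
  simp only [Nat.add_sub_cancel]
  rw [pairing_eq_sub μ h.le] at h0 ⊢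
  exact mvalI_sub hl (fun k => pairing μ 0 k) h (by simpa using h0)

/-- `⪰` is inclusion of cyclic arcs. -/
lemma posetGE_iff_wrap {n ℓ i : ℕ} (hl : 1 ≤ ℓ) {μ : Wt n} (hμ : IsDominant μ) {p q : Intv}
    (hp : InRi n i p) (hq : InRi n i q) :
    PosetGE ℓ μ p q ↔
      wrap ℓ (height ℓ μ) (p.1 - 1) (q.1 - 1) + wrap ℓ (height ℓ μ) (q.1 - 1) q.2 +
        wrap ℓ (height ℓ μ) q.2 p.2 = wrap ℓ (height ℓ μ) (p.1 - 1) p.2 := by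
  obtain ⟨p1, b⟩ := p
  obtain ⟨q1, b'⟩ := q
  obtain ⟨⟨h1, -, -⟩, h2, h3⟩ := hp
  obtain ⟨⟨k1, -, -⟩, k2, k3⟩ := hq
  dsimp only at *
  obtain ⟨a, rfl⟩ := Nat.exists_eq_add_of_le' h1
  obtain ⟨a', rfl⟩ := Nat.exists_eq_add_of_le' k1
  have hL : (0 : ℤ) < ℓ := by omega
  have swap := fun x y => wrap_add_swap (c := height ℓ μ) ℓ (x := x) (y := y)
  have tri := wrap_triangle hL (height ℓ μ)
  have self := wrap_self ℓ (height ℓ μ)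
  have m := fun x y => mIv_eq hl hμ (a := x) (b := y)
  generalize wrap ℓ (height ℓ μ) = W at *
  have e1 := m a b (by omega)
  have e2 := m a' b' (by omega)
  have e3 := m a b' (by omega)
  have e4 := m a' b (by omega)
  have t1 := tri a a' b
  have t2 := tri a' b' b
  have t3 := tri a a' b'
  have t4 := tri a b' b
  have ha := self a
  have hb := self b
  simp only [PosetGE, DiffIsRoot, cupR, capR, cupSubCap, gamma1, gamma2, cupSubFst, Prod.mk.injEq,
    Nat.add_sub_cancel]
  rcases lt_trichotomy a a' with h | h | h <;> rcases lt_trichotomy b b' with g | g | g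
  all_goals
    first
    | subst h
    | have f1 := swap a a' (by omega)
      first
      | have f2 := m a a' h
      | have f2 := m a' a h
    first
    | subst g
    | have f3 := swap b b' (by omega)
      first
      | have f4 := m b b' g
      | have f4 := m b' b g
    simp [*, le_of_lt, ne_of_lt, ne_of_gt, not_lt_of_gt]
  all_goals omega

/-- **STATEMENT 11.**  For every `λ ∈ P⁺`, `ℓ ≥ 1` and `i ∈ {1,…,n}`, the relation `⪰`
of the `(λ,i)`-poset is a partial order on `R_i⁺ = {α ∈ R⁺ : ϖ_i(h_α) = 1}`:
it is reflexive, antisymmetric and transitive. -/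
theorem lambda_i_poset_is_partialOrder
    (n ℓ i : ℕ) (hn : 1 ≤ n) (hl : 1 ≤ ℓ) (hi : 1 ≤ i) (hin : i ≤ n)
    (lam : Wt n) (hlam : IsDominant lam) :
    (∀ p : Intv, InRi n i p → PosetGE ℓ lam p p) ∧
    (∀ p q : Intv, InRi n i p → InRi n i q →
      PosetGE ℓ lam p q → PosetGE ℓ lam q p → p = q) ∧
    (∀ p q r : Intv, InRi n i p → InRi n i q → InRi n i r →
      PosetGE ℓ lam p q → PosetGE ℓ lam q r → PosetGE ℓ lam p r) := by
  have hL : (0 : ℤ) < ℓ := by omega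
  have tri := wrap_triangle hL (height ℓ lam)
  have pos := wrap_nonneg hL (height ℓ lam)
  have swap := fun x y => wrap_add_swap (c := height ℓ lam) ℓ (x := x) (y := y)
  refine ⟨fun p _ => Or.inl rfl, fun p q hp hq hpq hqp => ?_, fun p q r hp hq hr hpq hqr => ?_⟩
  · rw [posetGE_iff_wrap hl hlam hp hq] at hpq
    rw [posetGE_iff_wrap hl hlam hq hp] at hqp
    have h1 := pos (p.1 - 1) (q.1 - 1)
    have h2 := pos (q.1 - 1) (p.1 - 1)
    have h3 := pos p.2 q.2
    have h4 := pos q.2 p.2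
    have left : p.1 - 1 = q.1 - 1 := by
      by_contra h
      have := swap _ _ h
      omega
    have right : p.2 = q.2 := by
      by_contra h
      have := swap _ _ h
      omega
    have := hp.1.1
    have := hq.1.1
    exact Prod.ext (by omega) right
  · rw [posetGE_iff_wrap hl hlam hp hq] at hpq
    rw [posetGE_iff_wrap hl hlam hq hr] at hqr
    rw [posetGE_iff_wrap hl hlam hp hr]
    have h1 := tri (p.1 - 1) (q.1 - 1) (r.1 - 1)
    have h2 := tri r.2 q.2 p.2
    have h3 := tri (p.1 - 1) (r.1 - 1) p.2
    have h4 := tri (r.1 - 1) r.2 p.2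
    omega

end DemazurePaper
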